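/- Let K be a perfect field, A a noetherian henselian local K-algebra with residue field K and maximal ideal m, and B a finite A-algebra. Then the quotient homomorphism B → (B/mB)^red admits a section in the category of K-algebras, where (·)^red denotes the quotient by the nilradical. -/

import Mathlib

open scoped TensorProduct
open IsLocalRing

universe u v

/-- An étale neighbourhood of the closed point of a henselian local ring has a section. -/
theorem etale_section {A : Type u} [CommRing A] [HenselianLocalRing A]
    {E : Type u} [CommRing E] [Algebra A E] [Algebra.Etale A E]
    (P : Ideal E) [P.IsPrime] [P.LiesOver (maximalIdeal A)]
    (H : Function.Bijective (Ideal.ResidueField.mapₐ (maximalIdeal A) P (Algebra.ofId _ _)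
      (P.over_def (maximalIdeal A)))) :
    ∃ σ : E →ₐ[A] A, ∀ x, σ x ∈ maximalIdeal A ↔ x ∈ P := by
  let k := (maximalIdeal A).ResidueField
  let θ : k ≃ₐ[A] P.ResidueField := AlgEquiv.ofBijective _ H
  let ρ : E →ₐ[A] k := θ.symm.toAlgHom.comp (IsScalarTower.toAlgHom A E P.ResidueField)
  have hρ : ∀ x, ρ x = 0 ↔ x ∈ P := by
    intro x
    simp [ρ]
  have hk0 : ∀ a : A, algebraMap A k a = 0 ↔ a ∈ maximalIdeal A := by
    intro a
    simp [k]
  have hksurj : Function.Surjective (algebraMap A k) :=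
    (maximalIdeal A).algebraMap_residueField_surjective
  obtain ⟨f, hfP, hf⟩ := Algebra.IsEtaleAt.exists_isStandardEtale (R := A) P
  let S := hf.nonempty_standardEtalePresentation.some
  have hfu : IsUnit (ρ f) := by
    rw [isUnit_iff_ne_zero, Ne, hρ]; exact hfP
  let ρf : Localization.Away f →ₐ[A] k :=
    { IsLocalization.Away.lift (S := Localization.Away f) (g := (ρ : E →+* k)) f hfu with
      commutes' := by
        intro a
        rw [IsScalarTower.algebraMap_apply A E (Localization.Away f)]
        exact (IsLocalization.Away.lift_eq (S := Localization.Away f) (g := (ρ : E →+* k)) f hfu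
          _).trans (ρ.commutes a) }
  have hρf : ∀ x, ρf (algebraMap E _ x) = ρ x := fun x ↦ by
    exact IsLocalization.Away.lift_eq (S := Localization.Away f) (g := (ρ : E →+* k)) f hfu x
  have hx := S.hasMap.map ρf
  obtain ⟨a₀, ha₀⟩ := hksurj (ρf S.x)
  rw [← ha₀] at hx
  have hd := hx.isUnit_derivative_f
  obtain ⟨a, ha, haa⟩ := HenselianLocalRing.is_henselian S.f S.monic_f a₀
    (by rw [← hk0, ← hx.1, Polynomial.aeval_algebraMap_apply_eq_algebraMap_eval])
    (by
      rw [← notMem_maximalIdeal, ← hk0]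
      rw [Polynomial.aeval_algebraMap_apply_eq_algebraMap_eval] at hd
      exact hd.ne_zero)
  have haa' : algebraMap A k a = algebraMap A k a₀ := by
    rw [← sub_eq_zero, ← map_sub, hk0]; exact haa
  have hmap : S.HasMap a := by
    refine ⟨by simpa [Polynomial.IsRoot] using ha, ?_⟩
    have := hx.2
    rw [← haa', Polynomial.aeval_algebraMap_apply_eq_algebraMap_eval] at this
    rw [← notMem_maximalIdeal, ← hk0]
    simpa using this.ne_zero
  let σ' : Localization.Away f →ₐ[A] A := (S.lift a hmap).comp S.equivRing.toAlgHom
  have hcomp : (Algebra.ofId A k).comp σ' = ρf := by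
    have : ((Algebra.ofId A k).comp σ').comp S.equivRing.symm.toAlgHom
        = ρf.comp S.equivRing.symm.toAlgHom := by
      apply StandardEtalePair.hom_ext
      simp [σ', Algebra.ofId_apply, haa', ha₀]
    apply AlgHom.ext
    intro x
    have h2 := DFunLike.congr_fun this (S.equivRing x)
    simpa using h2
  refine ⟨σ'.comp (IsScalarTower.toAlgHom A E _), fun x ↦ ?_⟩
  rw [← hk0, ← hρ, ← hρf, ← hcomp]
  rfl

theorem lift_idempotent {A : Type u} [CommRing A] [HenselianLocalRing A]
    {S : Type v} [CommRing S] [Algebra A S] [Module.Finite A S] (b : S)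
    (hb : b * b - b ∈ ((maximalIdeal A).map (algebraMap A S)).radical) :
    ∃ e : S, IsIdempotentElem e ∧ e - b ∈ ((maximalIdeal A).map (algebraMap A S)).radical := by
  classical
  obtain ⟨E, _, _, _, P, _, _, n, e, he, P', _, _, hres, hP', HP⟩ :=
    Algebra.exists_etale_completeOrthogonalIdempotents_forall_liesOver_eq (S := S)
      (maximalIdeal A)
  obtain ⟨σ, hσ⟩ := etale_section P hres
  let τ : E ⊗[A] S →ₐ[A] S :=
    Algebra.TensorProduct.lift (((Algebra.ofId A S)).comp σ) (AlgHom.id A S) (fun _ _ ↦ .all _ _)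
  have hτ1 : ∀ s, τ (1 ⊗ₜ s) = s := by intro s; simp [τ]
  have hτ2 : ∀ x, τ (algebraMap E _ x) = algebraMap A S (σ x) := by
    intro s; simp [τ, Algebra.ofId_apply]
  have hτs : Function.Surjective τ := fun s ↦ ⟨_, hτ1 s⟩
  have he' := he.map τ.toRingHom
  set f : Fin (n+1) → S := fun i ↦ τ (e i) with hf
  have hfI : CompleteOrthogonalIdempotents f := he'
  have key : ∀ Q : Ideal S, Q.IsPrime → (maximalIdeal A).map (algebraMap A S) ≤ Q →
      f (.last n) ∈ Q ∧ ∀ i : Fin n, f i.castSucc ∉ Q → Q.comap τ = P' i := by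
    intro Q hQ hmQ
    have hQm : Q.comap (algebraMap A S) = maximalIdeal A := by
      symm
      exact (IsLocalRing.maximalIdeal.isMaximal A).eq_of_le
        (Ideal.IsPrime.ne_top inferInstance) (Ideal.map_le_iff_le_comap.mp hmQ)
    have hl : (Q.comap τ).LiesOver P := by
      constructor
      ext x
      rw [← hσ, Ideal.under_def, Ideal.mem_comap, Ideal.mem_comap, hτ2, ← hQm, Ideal.mem_comap]
    exact HP (Q.comap τ) inferInstance hl
  have uniq : ∀ Q Q' : Ideal S, Q.IsPrime → (maximalIdeal A).map (algebraMap A S) ≤ Q →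
      Q'.IsPrime → (maximalIdeal A).map (algebraMap A S) ≤ Q' →
      ∀ i, f i ∉ Q → f i ∉ Q' → Q = Q' := by
    intro Q Q' h1 h2 h3 h4 i
    induction i using Fin.lastCases with
    | last => intro h; exact absurd (key Q h1 h2).1 h
    | cast i =>
      intro h h'
      apply Ideal.comap_injective_of_surjective τ hτs
      rw [(key Q h1 h2).2 i h, (key Q' h3 h4).2 i h']
  let T : Finset (Fin (n+1)) := Finset.univ.filter fun i ↦
    ∃ Q : Ideal S, Q.IsPrime ∧ (maximalIdeal A).map (algebraMap A S) ≤ Q ∧ f i ∉ Q ∧ b ∉ Q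
  refine ⟨∑ i ∈ T, f i, hfI.toOrthogonalIdempotents.isIdempotentElem_sum, ?_⟩
  rw [Ideal.radical_eq_sInf] at hb ⊢
  rw [Submodule.mem_sInf] at hb ⊢
  rintro Q ⟨hmQ, hQ⟩
  have hbQ := hb Q ⟨hmQ, hQ⟩
  obtain ⟨i, hi⟩ : ∃ i, f i ∉ Q := by
    by_contra! h
    apply hQ.ne_top
    rw [Ideal.eq_top_iff_one, ← hfI.complete]
    exact Q.sum_mem fun i _ ↦ h i
  have hj : ∀ j, j ≠ i → f j ∈ Q := by
    intro j hji
    have : f j * f i ∈ Q := by rw [hfI.ortho hji]; exact Q.zero_mem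
    exact (hQ.mem_or_mem this).resolve_right hi
  have hi1 : f i - 1 ∈ Q := by
    have : f i * (f i - 1) ∈ Q := by
      rw [mul_sub, (hfI.idem i).eq, mul_one, sub_self]; exact Q.zero_mem
    exact (hQ.mem_or_mem this).resolve_left hi
  by_cases hbq : b ∈ Q
  · refine Q.sub_mem (Q.sum_mem fun j hj' ↦ ?_) hbq
    by_cases hji : j = i
    · subst hji
      obtain ⟨Q', h1, h2, h3, h4⟩ := (Finset.mem_filter.mp hj').2
      rw [uniq Q Q' hQ hmQ h1 h2 j hi h3] at hbq
      exact absurd hbq h4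
    · exact hj j hji
  · have hiT : i ∈ T := Finset.mem_filter.mpr ⟨Finset.mem_univ _, Q, hQ, hmQ, hi, hbq⟩
    have hb1 : b - 1 ∈ Q := by
      have : b * (b - 1) ∈ Q := by rwa [mul_sub, mul_one]
      exact (hQ.mem_or_mem this).resolve_left hbq
    rw [← Finset.add_sum_erase _ _ hiT]
    have h3 : ∑ j ∈ T.erase i, f j ∈ Q := Q.sum_mem fun j hj' ↦ hj j (Finset.ne_of_mem_erase hj')
    have : f i + ∑ j ∈ T.erase i, f j - b = (f i - 1) - (b - 1) + ∑ j ∈ T.erase i, f j := by ring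
    rw [this]
    exact Q.add_mem (Q.sub_mem hi1 hb1) h3

theorem section_of_unramified (K : Type*) [Field K] {A : Type u} [CommRing A] [HenselianLocalRing A]
    {B : Type*} [CommRing B] [Algebra A B] [Module.Finite A B] [Algebra K B]
    {C : Type*} [CommRing C] [Algebra K C] [Module.Finite K C] [Algebra.FormallyUnramified K C]
    (q : B →ₐ[K] C) (hq : Function.Surjective q)
    (hker : RingHom.ker q = ((maximalIdeal A).map (algebraMap A B)).radical) :
    ∃ s : C →ₐ[K] B, ∀ x, q (s x) = x := by
  classical
  set J : Ideal B := RingHom.ker q with hJ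
  have hJjac : J ≤ Ideal.jacobson ⊥ := by
    rw [hker, Ideal.jacobson, le_sInf_iff]
    rintro M ⟨-, hM⟩
    have hM' : (M.comap (algebraMap A B)).IsMaximal :=
      Ideal.isMaximal_comap_of_isIntegral_of_isMaximal M
    rw [(hM.isPrime.isRadical).radical_le_iff, Ideal.map_le_iff_le_comap,
      IsLocalRing.eq_maximalIdeal hM']
  let S := B ⊗[K] C
  have : Module.Finite A S := Module.Finite.trans B S
  let ε : C ⊗[K] C := Algebra.FormallyUnramified.elem K C
  let μ : C ⊗[K] C →ₐ[K] C := Algebra.TensorProduct.lmul' K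
  have hμε : μ ε = 1 := Algebra.FormallyUnramified.lmul_elem
  have hε : ∀ c : C, (1 ⊗ₜ c) * ε = (c ⊗ₜ 1) * ε :=
    fun c ↦ Algebra.FormallyUnramified.one_tmul_mul_elem c
  have hεx : ∀ x : C ⊗[K] C, x * ε = (μ x ⊗ₜ 1) * ε := by
    intro x
    induction x using TensorProduct.induction_on with
    | zero => simp
    | add x y hx hy => rw [add_mul, hx, hy, map_add, TensorProduct.add_tmul, add_mul]
    | tmul c d =>
      have : c ⊗ₜ[K] d = (c ⊗ₜ 1) * (1 ⊗ₜ d) := by simp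
      rw [this, mul_assoc, hε, ← mul_assoc]
      simp [μ]
  have hεi : IsIdempotentElem ε := by
    rw [IsIdempotentElem, hεx, hμε, ← Algebra.TensorProduct.one_def, one_mul]
  let π : S →ₐ[K] C ⊗[K] C := Algebra.TensorProduct.map q (AlgHom.id K C)
  have hπt : ∀ b c, π (b ⊗ₜ c) = q b ⊗ₜ c := fun _ _ ↦ rfl
  have hμt : ∀ c d, μ (c ⊗ₜ d) = c * d := fun c d ↦ Algebra.TensorProduct.lmul'_apply_tmul c d
  have hπs : Function.Surjective π := TensorProduct.map_surjective hq Function.surjective_id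
  have hπker : RingHom.ker π = J.map (Algebra.TensorProduct.includeLeft : B →ₐ[K] S) :=
    Algebra.TensorProduct.rTensor_ker _ hq
  set R := ((maximalIdeal A).map (algebraMap A S)).radical with hR
  have hπR : RingHom.ker π ≤ R := by
    rw [hπker, Ideal.map_le_iff_le_comap, hker]
    rw [hR, Ideal.comap_radical]
    apply Ideal.radical_mono
    rw [Ideal.map_le_iff_le_comap]
    intro a ha
    exact Ideal.mem_map_of_mem (algebraMap A S) ha
  have hRπ : ∀ x ∈ R, IsNilpotent (π x) := by
    rintro x ⟨n, hn⟩
    refine ⟨n, ?_⟩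
    rw [← map_pow]
    have : (maximalIdeal A).map (algebraMap A S) ≤ RingHom.ker π := by
      rw [Ideal.map_le_iff_le_comap]
      intro a ha
      have h1 : algebraMap A B a ∈ J := by
        rw [hker]; exact Ideal.le_radical (Ideal.mem_map_of_mem _ ha)
      rw [Ideal.mem_comap, hπker]
      exact Ideal.mem_map_of_mem (Algebra.TensorProduct.includeLeft : B →ₐ[K] S) h1
    exact this hn
  obtain ⟨b, hb⟩ := hπs ε
  obtain ⟨e, hei, heb⟩ := lift_idempotent (A := A) b (hπR (by
    rw [RingHom.mem_ker, map_sub, map_mul, hb, hεi.eq, sub_self]))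
  have hπe : π e = ε := by
    apply eq_of_isNilpotent_sub_of_isIdempotentElem_of_commute (hei.map π) hεi ?_ (.all _ _)
    rw [← hb, ← map_sub]
    exact hRπ _ heb
  let L : S →ₗ[B] S := LinearMap.mulLeft B e
  let M : Submodule B S := LinearMap.range L
  let φ₀ : B →ₗ[B] S := L.comp (Algebra.linearMap B S)
  have hφ₀ : ∀ b, φ₀ b = e * (b ⊗ₜ 1) := fun b ↦ rfl
  have hMφ : M ≤ LinearMap.range φ₀ := by
    apply Submodule.le_of_le_smul_of_le_jacobson_bot (I := J) ?_ hJjac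
    · rintro _ ⟨x, rfl⟩
      obtain ⟨y, hy⟩ := hq (μ (π x))
      have h1 : x * e - (y ⊗ₜ 1) * e ∈ RingHom.ker π := by
        rw [RingHom.mem_ker, map_sub, map_mul, map_mul, hπe, hεx, ← hy, hπt, sub_self]
      have h2 : L x = φ₀ y + L (x * e - (y ⊗ₜ 1) * e) := by
        rw [hφ₀]
        change e * x = e * (y ⊗ₜ 1) + e * (x * e - (y ⊗ₜ 1) * e)
        have := hei.eq
        linear_combination (x - (y ⊗ₜ 1)) * (-this)
      rw [h2]
      refine Submodule.add_mem_sup ⟨y, rfl⟩ ?_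
      have h3 : x * e - (y ⊗ₜ 1) * e ∈ J • (⊤ : Submodule B S) := by
        rw [hπker] at h1
        rw [Ideal.smul_top_eq_map]
        exact h1
      have h4 := Submodule.mem_map_of_mem (f := L) h3
      rwa [Submodule.map_smul'', Submodule.map_top] at h4
    · rw [show M = (⊤ : Submodule B S).map L from (Submodule.map_top L).symm]
      exact Module.Finite.fg_top.map L
  have hφM : ∀ b, φ₀ b ∈ M := fun b ↦ ⟨_, rfl⟩
  let φ : B →ₗ[B] M := φ₀.codRestrict M hφM
  have hφs : Function.Surjective φ := by
    rintro ⟨x, hx⟩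
    obtain ⟨y, hy⟩ := hMφ hx
    exact ⟨y, Subtype.ext hy⟩
  have hproj : Module.Projective B M := by
    refine Module.Projective.of_split M.subtype L.rangeRestrict ?_
    ext ⟨_, x, rfl⟩
    change e * (e * x) = e * x
    rw [← mul_assoc, hei.eq]
  obtain ⟨ψ, hψ⟩ := Module.projective_lifting_property φ LinearMap.id hφs
  have hinj : ∀ b : B, e * (b ⊗ₜ[K] (1:C)) = 0 → b = 0 := by
    intro b hb
    have hφb : φ b = 0 := Subtype.ext hb
    have hf0 : φ (1 - ψ (φ 1)) = 0 := by
      rw [map_sub, sub_eq_zero]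
      exact (DFunLike.congr_fun hψ (φ 1)).symm
    have hfJ : 1 - ψ (φ 1) ∈ J := by
      have h1 : e * ((1 - ψ (φ 1)) ⊗ₜ[K] (1:C)) = 0 := congrArg Subtype.val hf0
      have h2 := congrArg (fun z ↦ μ (π z)) h1
      simp only [map_mul, hπe, hμε, hπt, hμt, map_zero, one_mul, mul_one] at h2
      exact h2
    have hu : IsUnit (ψ (φ 1)) := by
      have := Ideal.mem_jacobson_bot.mp (hJjac hfJ) (-1)
      simpa using this
    have h3 : b * ψ (φ 1) = 0 := by
      rw [← smul_eq_mul, ← map_smul, ← map_smul, smul_eq_mul, mul_one, hφb, map_zero]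
    exact (hu.mul_left_eq_zero).mp h3
  have hinj' : ∀ b b' : B, e * (b ⊗ₜ[K] (1:C)) = e * (b' ⊗ₜ[K] (1:C)) → b = b' := by
    intro b b' h
    rw [← sub_eq_zero]
    apply hinj
    rw [TensorProduct.sub_tmul, mul_sub, h, sub_self]
  have hex : ∀ c : C, ∃ b : B, e * (b ⊗ₜ[K] (1:C)) = e * ((1:B) ⊗ₜ[K] c) := by
    intro c
    exact hMφ ⟨(1:B) ⊗ₜ[K] c, rfl⟩
  choose s hs using hex
  have hmul : ∀ c d, s (c * d) = s c * s d := by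
    intro c d
    apply hinj'
    have h1 : ((1:B) ⊗ₜ[K] (c * d)) = (1 ⊗ₜ c) * (1 ⊗ₜ d) := by simp
    have h2 : ((s c * s d) ⊗ₜ[K] (1:C)) = (s c ⊗ₜ 1) * (s d ⊗ₜ 1) := by simp
    rw [hs, h1, h2, ← mul_assoc, ← hs, mul_right_comm, ← hs]
    ring
  let s' : C →ₐ[K] B := 
    { toFun := s
      map_mul' := hmul
      map_one' := hinj' _ _ (hs 1)
      map_zero' := by apply hinj'; rw [hs]; simp
      map_add' := by
        intro c d
        apply hinj'
        rw [hs, TensorProduct.tmul_add, mul_add, ← hs, ← hs, TensorProduct.add_tmul, mul_add]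
      commutes' := by
        intro k
        apply hinj'
        rw [hs, Algebra.algebraMap_eq_smul_one, Algebra.algebraMap_eq_smul_one,
          TensorProduct.smul_tmul] }
  refine ⟨s', fun x ↦ ?_⟩
  have h2 := congrArg (fun z ↦ μ (π z)) (hs x)
  simp only [map_mul, hπe, hμε, hπt, hμt, map_one, one_mul, mul_one] at h2
  exact h2

theorem unramified_of_reduced (K C : Type*) [Field K] [PerfectField K] [CommRing C] [Algebra K C]
    [Module.Finite K C] [IsReduced C] : Algebra.FormallyUnramified K C := by
  have : IsArtinianRing C := .of_finite K C
  have (I : MaximalSpectrum C) : Algebra.FormallyEtale K (C ⧸ I.asIdeal) :=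
    letI : Field (C ⧸ I.asIdeal) := Ideal.Quotient.field I.asIdeal
    Algebra.FormallyEtale.of_isSeparable K _
  have : Algebra.FormallyEtale K C :=
    .of_equiv ((IsArtinianRing.equivPi C).restrictScalars K).symm
  infer_instance

/-- Let `K` be a perfect field, `A` a noetherian henselian local
`K`-algebra with residue field `K`, and `B` a finite `A`-algebra.  Then the
quotient map `B → (B/mB)ʳᵉᵈ` has a section in the category of `K`-algebras.
Here `(B/mB)ʳᵉᵈ` is realized as `B ⧸ (mB).radical`. -/
theorem stmt12 (K : Type*) [Field K] [PerfectField K]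
    (A : Type*) [CommRing A] [HenselianLocalRing A] [IsNoetherianRing A]
    [Algebra K A]
    (hres : Function.Bijective
      ((Ideal.Quotient.mk (IsLocalRing.maximalIdeal A)).comp (algebraMap K A)))
    (B : Type*) [CommRing B] [Algebra A B] [Module.Finite A B]
    [Algebra K B] [IsScalarTower K A B] :
    ∃ s : (B ⧸ (Ideal.map (algebraMap A B) (IsLocalRing.maximalIdeal A)).radical) →ₐ[K] B,
      ∀ x, Ideal.Quotient.mk
        ((Ideal.map (algebraMap A B) (IsLocalRing.maximalIdeal A)).radical) (s x) = x := by
  set J := (Ideal.map (algebraMap A B) (IsLocalRing.maximalIdeal A)).radical with hJ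
  have : IsReduced (B ⧸ J) :=
    (Ideal.isRadical_iff_quotient_reduced J).mp (Ideal.radical_isRadical _)
  have hfin : Module.Finite K (B ⧸ J) := by
    obtain ⟨t, ht⟩ := (inferInstance : Module.Finite A (B ⧸ J)).fg_top
    refine ⟨t, ?_⟩
    rw [eq_top_iff]
    intro x _
    have hx : x ∈ Submodule.span A (t : Set (B ⧸ J)) := by rw [ht]; trivial
    induction hx using Submodule.span_induction with
    | mem x h => exact Submodule.subset_span h
    | zero => exact Submodule.zero_mem _
    | add x y _ _ hx hy => exact Submodule.add_mem _ (hx trivial) (hy trivial)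
    | smul a x _ hx =>
      obtain ⟨k, hk⟩ := hres.2 (Ideal.Quotient.mk _ a)
      have hk' : algebraMap K A k - a ∈ maximalIdeal A := Ideal.Quotient.eq.mp hk
      have h0 : (algebraMap K A k - a) • x = 0 := by
        obtain ⟨y, rfl⟩ := Ideal.Quotient.mk_surjective x
        change Ideal.Quotient.mk J ((algebraMap K A k - a) • y) = 0
        rw [Ideal.Quotient.eq_zero_iff_mem, Algebra.smul_def]
        exact J.mul_mem_right _ (Ideal.le_radical (Ideal.mem_map_of_mem _ hk'))
      rw [sub_smul, sub_eq_zero, algebraMap_smul] at h0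
      rw [← h0]
      exact Submodule.smul_mem _ _ (hx trivial)
  have := unramified_of_reduced K (B ⧸ J)
  exact section_of_unramified K (A := A) (Ideal.Quotient.mkₐ K J)
    (Ideal.Quotient.mkₐ_surjective K J) (Ideal.Quotient.mkₐ_ker K J)
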